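/- arXiv:1305.4818 — 3 statements merged into one kernel-verified Lean document; each statement's English description precedes it below -/
import Mathlib

section
/- For every z ∈ ℂ with z ∉ (-∞,0], the derivative at ν = 0 of the map ν ↦ j_ν(z) equals (Ci(2z)·sin z − Si(2z)·cos z)/z. -/
open Complex

/-- The Bessel function of the first kind
`J_ν(z) = (z/2)^ν ∑_{k≥0} (−1)^k (z²/4)^k / (k! Γ(ν+k+1))`, with the principal power. -/
noncomputable def besselJ (ν z : ℂ) : ℂ :=
  (z / 2) ^ ν *
    ∑' k : ℕ, (-1) ^ k * (z ^ 2 / 4) ^ k / ((k.factorial : ℂ) * Complex.Gamma (ν + k + 1))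

/-- The spherical Bessel function of the first kind `j_ν(z) = √(π/(2z)) J_{ν+1/2}(z)`. -/
noncomputable def sphBesselJ (ν z : ℂ) : ℂ :=
  ((Real.pi : ℂ) / (2 * z)) ^ ((1 : ℂ) / 2) * besselJ (ν + 1 / 2) z

/-- The sine integral `Si(z) = ∑_{n≥0} (−1)ⁿ z^{2n+1}/((2n+1)(2n+1)!)`. -/
noncomputable def sinIntegral (z : ℂ) : ℂ :=
  ∑' n : ℕ, (-1) ^ n * z ^ (2 * n + 1) / ((2 * (n : ℂ) + 1) * ((2 * n + 1).factorial : ℂ))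

/-- The cosine integral `Ci(z) = γ + Log z + ∑_{n≥1} (−1)ⁿ z^{2n}/(2n·(2n)!)`. -/
noncomputable def cosIntegral (z : ℂ) : ℂ :=
  (Real.eulerMascheroniConstant : ℂ) + Complex.log z +
    ∑' n : ℕ, (-1) ^ (n + 1) * z ^ (2 * (n + 1)) /
      ((2 * ((n : ℂ) + 1)) * ((2 * (n + 1)).factorial : ℂ))


lemma hasSum_of_eq {f g : ℕ → ℂ} {s : ℂ} (h : ∀ n, f n = g n) (hg : HasSum g s) : HasSum f s := by
  rwa [funext h]

noncomputable def auxH (k : ℕ) : ℂ := ∑ m ∈ Finset.range (k + 1), 2 / (2 * (m : ℂ) + 1)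

noncomputable def auxB (N : ℕ) : ℂ :=
  ∑ n ∈ Finset.range (N + 1), (N.choose n : ℂ) * (-2) ^ n / n

noncomputable def auxE (x : ℂ) : ℂ := ∑' n : ℕ, x ^ n / ((n : ℂ) * (n.factorial : ℂ))

lemma auxB_succ (N : ℕ) : auxB (N + 1) = auxB N + ((-1) ^ (N + 1) - 1) / (N + 1) := by
  have h1 : auxB N = ∑ n ∈ Finset.range (N + 1), (N.choose (n + 1) : ℂ) * (-2) ^ (n + 1) / (n + 1 : ℕ) := by
    unfold auxB
    rw [Finset.sum_range_succ', Finset.sum_range_succ]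
    simp
  have h2 : auxB (N + 1) = ∑ n ∈ Finset.range (N + 1),
      ((N + 1).choose (n + 1) : ℂ) * (-2) ^ (n + 1) / (n + 1 : ℕ) := by
    unfold auxB
    rw [Finset.sum_range_succ']
    simp
  have h3 : ((-1 : ℂ)) ^ (N + 1) - 1 = ∑ n ∈ Finset.range (N + 1),
      ((N + 1).choose (n + 1) : ℂ) * (-2) ^ (n + 1) := by
    have := add_pow (-2 : ℂ) 1 (N + 1)
    rw [Finset.sum_range_succ'] at this
    norm_num at this
    rw [this]
    simp [mul_comm]
  rw [h1, h2, h3, Finset.sum_div, ← Finset.sum_add_distrib]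
  refine Finset.sum_congr rfl fun n _ => ?_
  have h4 : ((N : ℂ) + 1) * (N.choose n) = ((N + 1).choose (n + 1)) * (n + 1) := by
    exact_mod_cast Nat.add_one_mul_choose_eq N n
  have h5 : ((N + 1).choose (n + 1) : ℂ) = N.choose n + N.choose (n + 1) := by
    exact_mod_cast Nat.choose_succ_succ N n
  have hN : (N : ℂ) + 1 ≠ 0 := by exact_mod_cast Nat.succ_ne_zero N
  have hn : (n : ℂ) + 1 ≠ 0 := by exact_mod_cast Nat.succ_ne_zero n
  have h6 : ((N + 1).choose (n + 1) : ℂ) / (N + 1) = N.choose n / (n + 1) := by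
    rw [div_eq_div_iff hN hn, ← h4]; ring
  have h7 : ((N + 1).choose (n + 1) : ℂ) * (-2) ^ (n + 1) / (N + 1)
      = N.choose n / (n + 1) * (-2) ^ (n + 1) := by rw [← h6]; ring
  rw [h7, h5]
  push_cast
  ring

lemma auxB_odd (k : ℕ) : auxB (2 * k + 1) = -auxH k := by
  induction k with
  | zero => simp [auxB, auxH, Finset.sum_range_succ]
  | succ k ih =>
    have : 2 * (k + 1) + 1 = (2 * k + 1) + 1 + 1 := by ring
    rw [this, auxB_succ, auxB_succ, ih]
    have e1 : (-1 : ℂ) ^ (2 * k + 1 + 1) = 1 := Even.neg_one_pow ⟨k + 1, by ring⟩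
    have e2 : (-1 : ℂ) ^ (2 * k + 1 + 1 + 1) = -1 := Odd.neg_one_pow ⟨k + 1, by ring⟩
    rw [e1, e2]
    unfold auxH
    rw [Finset.sum_range_succ _ (k + 1)]
    push_cast
    ring

lemma auxE_summable (x : ℂ) : Summable fun n : ℕ => ‖x ^ n / ((n : ℂ) * (n.factorial : ℂ))‖ := by
  refine Summable.of_nonneg_of_le (fun _ => norm_nonneg _) (fun n => ?_)
    (Real.summable_pow_div_factorial ‖x‖)
  rw [norm_div, norm_mul, norm_pow, norm_natCast, norm_natCast]
  rcases Nat.eq_zero_or_pos n with rfl | hn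
  · simp
  · have : (1 : ℝ) ≤ n := by exact_mod_cast hn
    have hf : (0 : ℝ) < n.factorial := by exact_mod_cast n.factorial_pos
    gcongr
    nlinarith

lemma exp_mul_auxE (w : ℂ) : HasSum (fun N : ℕ => (-w) ^ N * auxB N / (N.factorial : ℂ))
    (Complex.exp (-w) * auxE (2 * w)) := by
  have hs1 : Summable fun n : ℕ => ‖(-w) ^ n / (n.factorial : ℂ)‖ := by
    simpa [norm_div, norm_pow] using Real.summable_pow_div_factorial ‖w‖
  have hs2 := auxE_summable (2 * w)
  have h := tsum_mul_tsum_eq_tsum_sum_antidiagonal_of_summable_norm hs2 hs1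
  have h' := (summable_norm_sum_mul_antidiagonal_of_summable_norm hs2 hs1).of_norm.hasSum
  rw [← h] at h'
  have hexp : Complex.exp (-w) = ∑' n : ℕ, (-w) ^ n / (n.factorial : ℂ) := by
    rw [Complex.exp_eq_exp_ℂ, NormedSpace.exp_eq_tsum_div]
  rw [hexp, auxE, mul_comm]
  refine hasSum_of_eq (fun N => ?_) h'
  rw [Finset.Nat.sum_antidiagonal_eq_sum_range_succ_mk, auxB, Finset.mul_sum, Finset.sum_div]
  refine Finset.sum_congr rfl fun n hn => ?_
  have hn : n ≤ N := by simpa [Nat.lt_succ_iff] using hn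
  have hc : (N.choose n : ℂ) = N.factorial / (n.factorial * (N - n).factorial) := Nat.cast_choose ℂ hn
  have f1 : (N.factorial : ℂ) ≠ 0 := by exact_mod_cast N.factorial_ne_zero
  have f2 : (n.factorial : ℂ) ≠ 0 := by exact_mod_cast n.factorial_ne_zero
  have f3 : ((N - n).factorial : ℂ) ≠ 0 := by exact_mod_cast (N - n).factorial_ne_zero
  have hp : (-w) ^ N = (-w) ^ n * (-w) ^ (N - n) := by rw [← pow_add]; congr 1; omega
  have hq : (-w) ^ n * (-2) ^ n = (2 * w) ^ n := by rw [← mul_pow]; ring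
  rw [hc, ← hq, hp]
  rcases Nat.eq_zero_or_pos n with rfl | h0
  · simp
  · have : (n : ℂ) ≠ 0 := by exact_mod_cast h0.ne'
    field_simp

noncomputable def auxC (z : ℂ) : ℂ := ∑' n : ℕ, (-1) ^ (n + 1) * z ^ (2 * (n + 1)) /
      ((2 * ((n : ℂ) + 1)) * ((2 * (n + 1)).factorial : ℂ))

lemma auxE_eq (z : ℂ) : auxE (I * z) = auxC z + I * sinIntegral z := by
  have hs := (auxE_summable (I * z)).of_norm
  have he : Summable fun n : ℕ => (I * z) ^ (2 * n) / (((2 * n : ℕ) : ℂ) * ((2 * n).factorial : ℂ)) :=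
    hs.comp_injective (i := fun n : ℕ => 2 * n) (fun a b h => by simpa using h)
  have ho : Summable fun n : ℕ => (I * z) ^ (2 * n + 1) / (((2 * n + 1 : ℕ) : ℂ) * ((2 * n + 1).factorial : ℂ)) :=
    hs.comp_injective (i := fun n : ℕ => 2 * n + 1) (fun a b h => by simpa using h)
  unfold auxE
  rw [← tsum_even_add_odd (f := fun n : ℕ => (I * z) ^ n / ((n : ℂ) * (n.factorial : ℂ))) he ho, he.tsum_eq_zero_add]
  unfold auxC sinIntegral
  rw [← tsum_mul_left]
  congr 1
  · simp only [mul_zero, Nat.cast_zero, zero_mul, div_zero, zero_add]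
    refine tsum_congr fun n => ?_
    rw [mul_pow, pow_mul I, I_sq]
    push_cast
    ring
  · refine tsum_congr fun n => ?_
    rw [mul_pow, pow_succ I, pow_mul I, I_sq]
    push_cast
    ring

lemma key (z : ℂ) : HasSum (fun k : ℕ => (-1) ^ k * z ^ (2 * k + 1) * auxH k / ((2 * k + 1).factorial : ℂ))
    (-(auxC (2 * z) * Complex.sin z - sinIntegral (2 * z) * Complex.cos z)) := by
  have h1 := exp_mul_auxE (I * z)
  have h2 := exp_mul_auxE (-(I * z))
  have e1 : (2 * (I * z)) = I * (2 * z) := by ring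
  have e2 : (2 * -(I * z)) = I * (-(2 * z)) := by ring
  have c : auxC (-(2 * z)) = auxC (2 * z) := by
    unfold auxC
    refine tsum_congr fun n => ?_
    rw [Even.neg_pow (⟨n + 1, by ring⟩ : Even (2 * (n + 1))) (2 * z)]
  have s : sinIntegral (-(2 * z)) = -sinIntegral (2 * z) := by
    unfold sinIntegral
    rw [← tsum_neg]
    refine tsum_congr fun n => ?_
    rw [Odd.neg_pow (⟨n, by ring⟩ : Odd (2 * n + 1)) (2 * z)]; ring
  rw [e1, auxE_eq] at h1
  rw [e2, auxE_eq, c, s] at h2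
  have h := (h1.sub h2).mul_left (1 / (2 * I))
  have hev : ∀ x ∉ Set.range (fun k : ℕ => 2 * k + 1),
      1 / (2 * I) * ((-(I * z)) ^ x * auxB x / (x.factorial : ℂ) -
        (- -(I * z)) ^ x * auxB x / (x.factorial : ℂ)) = 0 := by
    intro x hx
    have : Even x := by
      by_contra hh
      obtain ⟨k, hk⟩ := Nat.not_even_iff_odd.1 hh
      exact hx ⟨k, hk.symm⟩
    rw [this.neg_pow (-(I * z))]; simp
  have inj : Function.Injective (fun k : ℕ => 2 * k + 1) := fun a b h => by simpa using h
  have h' := (inj.hasSum_iff hev).2 h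
  convert h' using 1
  · ext k
    simp only [Function.comp]
    rw [auxB_odd, neg_neg, Odd.neg_pow (⟨k, rfl⟩ : Odd (2 * k + 1)) (I * z), mul_pow, pow_succ I, pow_mul I, I_sq]
    field_simp
    ring
  · have x1 : Complex.exp (-(I * z)) = Complex.cos z - Complex.sin z * I := by
      rw [show -(I * z) = (-z) * I by ring, Complex.exp_mul_I, Complex.cos_neg, Complex.sin_neg]; ring
    have x2 : Complex.exp (- -(I * z)) = Complex.cos z + Complex.sin z * I := by
      rw [neg_neg, mul_comm, Complex.exp_mul_I]
    rw [x1, x2]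
    field_simp
    ring

lemma gamma_half (k : ℕ) : (k.factorial : ℂ) * Complex.Gamma (1 / 2 + k + 1) =
    (Real.pi : ℂ) ^ (1 / 2 : ℂ) * ((2 * k + 1).factorial : ℂ) / 2 ^ (2 * k + 1) := by
  induction k with
  | zero =>
    simp only [Nat.cast_zero, add_zero]
    rw [Complex.Gamma_add_one _ (by norm_num), Complex.Gamma_one_half_eq]
    simp; ring
  | succ k ih =>
    have hne : (1 / 2 + (k : ℂ) + 1) ≠ 0 := by
      intro h
      have := congrArg Complex.re h
      simp at this
      have : (0:ℝ) ≤ k := by positivity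
      linarith
    push_cast
    rw [← add_assoc (1 / 2 : ℂ), Complex.Gamma_add_one _ hne]
    have : 2 * (k + 1) + 1 = (2 * k + 1) + 1 + 1 := by ring
    rw [this, Nat.factorial_succ (2 * k + 1 + 1), Nat.factorial_succ (2 * k + 1), Nat.factorial_succ k]
    have : (((k + 1) * k.factorial : ℕ) : ℂ) * ((1 / 2 + k + 1) * Complex.Gamma (1 / 2 + k + 1))
       = (k + 1) * (1 / 2 + k + 1) * (k.factorial * Complex.Gamma (1 / 2 + k + 1)) := by
      push_cast; ring
    rw [this, ih]
    push_cast
    field_simp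
    ring

lemma digamma_half (k : ℕ) : Complex.digamma (1 / 2 + k + 1) =
    - 2 * Complex.log 2 - Real.eulerMascheroniConstant + auxH k := by
  have key : ∀ k : ℕ, ∀ m : ℕ, (1 / 2 + (k : ℂ)) ≠ -m := by
    intro k m h
    have := congrArg Complex.re h
    simp at this
    have : (0:ℝ) ≤ k := by positivity
    have : (0:ℝ) ≤ m := by positivity
    linarith
  have hr : ∀ k : ℕ, (1 / 2 + (k : ℂ))⁻¹ = 2 / (2 * k + 1) := by
    intro k
    have := key k 0
    rw [inv_eq_one_div, div_eq_div_iff]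
    · ring
    · simpa using this
    · intro h
      apply this
      simp; linear_combination h / 2
  induction k with
  | zero =>
    rw [Complex.digamma_apply_add_one _ (key 0), hr]
    simp only [Nat.cast_zero, add_zero]
    rw [Complex.digamma_one_half]
    simp [auxH]
  | succ k ih =>
    rw [Complex.digamma_apply_add_one _ (key (k + 1)), hr]
    push_cast
    rw [← add_assoc, ih]
    unfold auxH
    rw [Finset.sum_range_succ _ (k + 1)]
    push_cast
    ring

lemma gamma_ne (k : ℕ) {ν : ℂ} (h : -(1/2) < ν.re) : ∀ m : ℕ, (ν + 1 / 2 + k + 1) ≠ -m := by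
  intro m h'
  have := congrArg Complex.re h'
  simp at this
  have : (0:ℝ) ≤ k := by positivity
  have : (0:ℝ) ≤ m := by positivity
  linarith

lemma gamma_bound (k : ℕ) {ν : ℂ} (h : -(1/2) < ν.re) :
    ‖(Complex.Gamma (ν + 1 / 2 + k + 1))⁻¹‖ ≤ ‖(Complex.Gamma (ν + 1 / 2 + 1))⁻¹‖ := by
  induction k with
  | zero => simp
  | succ k ih =>
    have hne := gamma_ne k h 0
    push_cast
    rw [← add_assoc, Complex.Gamma_add_one _ (by simpa using hne), mul_inv, norm_mul]
    have : ‖(ν + 1 / 2 + (k : ℂ) + 1)⁻¹‖ ≤ 1 := by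
      rw [norm_inv]
      apply inv_le_one_of_one_le₀
      refine le_trans ?_ (Complex.re_le_norm _)
      simp
      have : (0:ℝ) ≤ k := by positivity
      linarith
    calc _ ≤ 1 * ‖(Complex.Gamma (ν + 1 / 2 + k + 1))⁻¹‖ := by gcongr
      _ ≤ _ := by rw [one_mul]; exact ih

noncomputable def auxF (z : ℂ) (k : ℕ) (ν : ℂ) : ℂ :=
  (-1) ^ k * (z ^ 2 / 4) ^ k / ((k.factorial : ℂ) * Complex.Gamma (ν + 1 / 2 + k + 1))

lemma auxF_deriv (z : ℂ) (k : ℕ) : deriv (auxF z k) 0 = - auxF z k 0 *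
    Complex.digamma (1 / 2 + k + 1) := by
  have hne := gamma_ne k (ν := 0) (by norm_num)
  have hd : HasDerivAt Complex.Gamma (deriv Complex.Gamma (0 + 1 / 2 + k + 1)) (0 + 1 / 2 + k + 1) :=
    (Complex.differentiableAt_Gamma _ hne).hasDerivAt
  have hg : Complex.Gamma (0 + 1 / 2 + k + 1) ≠ 0 := Complex.Gamma_ne_zero hne
  have hl : HasDerivAt (fun ν : ℂ => ν + 1 / 2 + k + 1) 1 0 :=
    (((hasDerivAt_id (0:ℂ)).add_const _).add_const _).add_const _
  have hf : (k.factorial : ℂ) ≠ 0 := by exact_mod_cast k.factorial_ne_zero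
  have h1 := hd.comp (0 : ℂ) hl
  have h2 := (h1.const_mul (k.factorial : ℂ)).fun_inv (by exact mul_ne_zero hf hg)
  have h3 := h2.const_mul ((-1) ^ k * (z ^ 2 / 4) ^ k)
  have : auxF z k = fun ν => (-1) ^ k * (z ^ 2 / 4) ^ k *
    ((k.factorial : ℂ) * (Complex.Gamma ∘ fun ν : ℂ => ν + 1 / 2 + k + 1) ν)⁻¹ := by
    ext ν; simp [auxF, div_eq_mul_inv]
  rw [this, h3.deriv]
  simp only [Function.comp, Complex.digamma, logDeriv_apply]
  simp only [zero_add] at hg ⊢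
  field_simp

lemma auxF_sum (z : ℂ) : DifferentiableAt ℂ (fun ν => ∑' k, auxF z k ν) 0 ∧
    HasSum (fun k => deriv (auxF z k) 0) (deriv (fun ν => ∑' k, auxF z k ν) 0) := by
  set M : ℝ := ‖(Complex.Gamma ((0:ℂ) + 1 / 2 + 1))⁻¹‖ + 1
  set U : Set ℂ := {ν | -(1/2) < ν.re} ∩ {ν | ‖(Complex.Gamma (ν + 1 / 2 + 1))⁻¹‖ < M}
  have hcont : Continuous fun ν : ℂ => ‖(Complex.Gamma (ν + 1 / 2 + 1))⁻¹‖ := by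
    have := Complex.differentiable_one_div_Gamma.continuous
    exact (this.comp (by fun_prop : Continuous fun ν : ℂ => ν + 1 / 2 + 1)).norm
  have hU : IsOpen U :=
    (isOpen_lt continuous_const Complex.continuous_re).inter (isOpen_lt hcont continuous_const)
  have h0 : (0 : ℂ) ∈ U := ⟨by simp, by simp [M]⟩
  have hu : Summable fun k : ℕ => ‖z ^ 2 / 4‖ ^ k / (k.factorial : ℝ) * M :=
    (Real.summable_pow_div_factorial _).mul_right _
  have hle : ∀ (k : ℕ) (ν : ℂ), ν ∈ U → ‖auxF z k ν‖ ≤ ‖z ^ 2 / 4‖ ^ k / (k.factorial : ℝ) * M := by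
    intro k ν hν
    have := (gamma_bound k hν.1).trans hν.2.le
    have e : auxF z k ν = (-1) ^ k * ((z ^ 2 / 4) ^ k / (k.factorial : ℂ)) *
        (Complex.Gamma (ν + 1 / 2 + k + 1))⁻¹ := by
      unfold auxF
      rw [div_eq_mul_inv, mul_inv]; ring
    rw [e, norm_mul, norm_mul, norm_div, norm_pow, norm_pow, norm_natCast, norm_neg, norm_one,
      one_pow, one_mul]
    gcongr
  have hf : ∀ k, DifferentiableOn ℂ (auxF z k) U := by
    intro k ν hν
    have hne := gamma_ne k hν.1
    have hk : (k.factorial : ℂ) ≠ 0 := by exact_mod_cast k.factorial_ne_zero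
    have hg : DifferentiableAt ℂ (fun ν : ℂ => Complex.Gamma (ν + 1 / 2 + k + 1)) ν :=
      (Complex.differentiableAt_Gamma _ hne).comp ν (by fun_prop)
    refine DifferentiableAt.differentiableWithinAt ?_
    unfold auxF
    exact (differentiableAt_const _).fun_div (hg.const_mul _) (mul_ne_zero hk (Complex.Gamma_ne_zero hne))
  exact ⟨(Complex.differentiableOn_tsum_of_summable_norm hu hf hU hle).differentiableAt
    (hU.mem_nhds h0), Complex.hasSum_deriv_of_summable_norm hu hf hU hle h0⟩

lemma prefactor (z : ℂ) (hz : z ∈ Complex.slitPlane) :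
    ((Real.pi : ℂ) / (2 * z)) ^ ((1 : ℂ) / 2) * (z / 2) ^ ((1 : ℂ) / 2) =
      (Real.pi : ℂ) ^ (1 / 2 : ℂ) / 2 := by
  have hz0 : z ≠ 0 := Complex.slitPlane_ne_zero hz
  have hp : (Real.pi : ℂ) ≠ 0 := by exact_mod_cast Real.pi_ne_zero
  have harg : z.arg ≠ Real.pi := Complex.slitPlane_arg_ne_pi hz
  have l1 : Complex.log ((Real.pi : ℂ) / (2 * z)) = Complex.log Real.pi - Complex.log 2 - Complex.log z := by
    have : (Real.pi : ℂ) / (2 * z) = ((Real.pi / 2 : ℝ) : ℂ) * z⁻¹ := by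
      push_cast; field_simp
    rw [this, Complex.log_ofReal_mul (by positivity) (inv_ne_zero hz0), Complex.log_inv _ harg,
      Real.log_div Real.pi_ne_zero two_ne_zero]
    push_cast [Complex.ofReal_log Real.pi_pos.le]
    rw [Complex.ofReal_log (by norm_num : (0:ℝ) ≤ 2)]
    push_cast; ring
  have l2 : Complex.log (z / 2) = Complex.log z - Complex.log 2 := by
    have : z / 2 = ((1 / 2 : ℝ) : ℂ) * z := by push_cast; ring
    rw [this, Complex.log_ofReal_mul (by norm_num) hz0, one_div, Real.log_inv]
    push_cast
    rw [Complex.ofReal_log (by norm_num : (0:ℝ) ≤ 2)]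
    push_cast; ring
  rw [Complex.cpow_def_of_ne_zero (div_ne_zero hp (by simpa using hz0)),
    Complex.cpow_def_of_ne_zero (div_ne_zero hz0 two_ne_zero), Complex.cpow_def_of_ne_zero hp,
    ← Complex.exp_add, l1, l2]
  have h2 : Complex.exp (Complex.log Real.pi * (1 / 2)) / 2 =
      Complex.exp (Complex.log Real.pi * (1 / 2) - Complex.log 2) := by
    rw [Complex.exp_sub, Complex.exp_log two_ne_zero]
  rw [h2]
  congr 1
  ring

lemma auxF_zero (z : ℂ) (hz : z ≠ 0) (k : ℕ) : (Real.pi : ℂ) ^ (1 / 2 : ℂ) / 2 * auxF z k 0 =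
    (-1) ^ k * z ^ (2 * k + 1) / ((2 * k + 1).factorial : ℂ) / z := by
  have hp : (Real.pi : ℂ) ^ (1 / 2 : ℂ) ≠ 0 := by
    rw [← Complex.Gamma_one_half_eq]
    exact Complex.Gamma_ne_zero_of_re_pos (by norm_num)
  have f : ((2 * k + 1).factorial : ℂ) ≠ 0 := by exact_mod_cast (2 * k + 1).factorial_ne_zero
  unfold auxF
  rw [zero_add, gamma_half, div_pow, ← pow_mul, pow_succ, pow_succ, pow_mul 2]
  norm_num
  field_simp

theorem stmt6 (z : ℂ) (hz : z ∉ Complex.ofReal '' Set.Iic (0 : ℝ)) :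
    deriv (fun ν : ℂ => sphBesselJ ν z) 0 =
      (cosIntegral (2 * z) * Complex.sin z - sinIntegral (2 * z) * Complex.cos z) / z := by
  have hzs : z ∈ Complex.slitPlane := by
    by_contra h
    rw [Complex.mem_slitPlane_iff] at h
    push Not at h
    exact hz ⟨z.re, h.1, Complex.ext rfl (by simp [h.2])⟩
  have hz0 : z ≠ 0 := Complex.slitPlane_ne_zero hzs
  have hz2 : z / 2 ≠ 0 := div_ne_zero hz0 two_ne_zero
  obtain ⟨hd, hs⟩ := auxF_sum z
  set P : ℂ := (Real.pi : ℂ) ^ (1 / 2 : ℂ) / 2 with hP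
  -- derivative of the power factor
  have hpow : HasDerivAt (fun ν : ℂ => (z / 2) ^ (ν + 1 / 2))
      ((z / 2) ^ ((0:ℂ) + 1 / 2) * Complex.log (z / 2) * 1) 0 :=
    ((hasDerivAt_id (0:ℂ)).add_const (1 / 2 : ℂ)).const_cpow (Or.inl hz2)
  have hmain := (hpow.mul hd.hasDerivAt).const_mul (((Real.pi : ℂ) / (2 * z)) ^ ((1 : ℂ) / 2))
  have hfun : (fun ν : ℂ => sphBesselJ ν z) = fun ν => ((Real.pi : ℂ) / (2 * z)) ^ ((1 : ℂ) / 2) *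
      ((fun ν : ℂ => (z / 2) ^ (ν + 1 / 2)) * (fun ν => ∑' k, auxF z k ν)) ν := by
    ext ν
    simp only [sphBesselJ, besselJ, auxF, Pi.mul_apply]
  rw [hfun, hmain.deriv]
  have hsin : HasSum (fun k => P * auxF z k 0) (Complex.sin z / z) :=
    hasSum_of_eq (fun k => auxF_zero z hz0 k) ((Complex.hasSum_sin z).div_const z)
  have hS0 : P * ∑' k, auxF z k 0 = Complex.sin z / z := by
    rw [← tsum_mul_left, hsin.tsum_eq]
  set L : ℂ := - 2 * Complex.log 2 - Real.eulerMascheroniConstant with hL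
  have hder : HasSum (fun k => P * deriv (auxF z k) 0)
      (-L * (Complex.sin z / z) -
        -(auxC (2 * z) * Complex.sin z - sinIntegral (2 * z) * Complex.cos z) / z) := by
    refine hasSum_of_eq (fun k => ?_) ((hsin.mul_left (-L)).sub ((key z).div_const z))
    rw [auxF_deriv, digamma_half, ← hL]
    have := auxF_zero z hz0 k
    rw [← hP] at this
    linear_combination (-auxH k) * this
  have hD := (hs.mul_left P).unique hder
  have hpre := prefactor z hzs
  rw [← hP] at hpre
  have hlog : Complex.log (2 * z) = Complex.log (z / 2) + 2 * Complex.log 2 := by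
    have e1 : (2 * z) = ((4 : ℝ) : ℂ) * (z / 2) := by push_cast; ring
    rw [e1, Complex.log_ofReal_mul (by norm_num) hz2, show (4 : ℝ) = 2 ^ 2 by norm_num, Real.log_pow]
    push_cast
    rw [Complex.ofReal_log (by norm_num : (0:ℝ) ≤ 2)]
    push_cast; ring
  have hC : cosIntegral (2 * z) =
      (Real.eulerMascheroniConstant : ℂ) + Complex.log (2 * z) + auxC (2 * z) := rfl
  rw [hC, hlog, zero_add, mul_one]
  calc _ = (((Real.pi : ℂ) / (2 * z)) ^ ((1 : ℂ) / 2) * (z / 2) ^ ((1 : ℂ) / 2)) *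
        (Complex.log (z / 2) * ∑' k, auxF z k 0 + deriv (fun ν => ∑' k, auxF z k ν) 0) := by ring
    _ = Complex.log (z / 2) * (P * ∑' k, auxF z k 0) + P * deriv (fun ν => ∑' k, auxF z k ν) 0 := by
        rw [hpre]; ring
    _ = _ := by
        rw [hS0, hD, hL]; ring
end

section
/- For every z ∈ ℂ with z ∉ (-∞,0], the derivative at ν = 0 of the map ν ↦ y_ν(z) equals (Ci(2z)·cos z + (Si(2z) − π)·sin z)/z. -/
open Complex

/-- The spherical Bessel function of the second kind
`y_ν(z) = √(π/(2z)) (J_{ν+1/2}(z) cos((ν+1/2)π) − J_{−ν−1/2}(z)) / sin((ν+1/2)π)`. -/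
noncomputable def sphBesselY (ν z : ℂ) : ℂ :=
  ((Real.pi : ℂ) / (2 * z)) ^ ((1 : ℂ) / 2) *
    (besselJ (ν + 1 / 2) z * Complex.cos ((ν + 1 / 2) * Real.pi) - besselJ (-ν - 1 / 2) z) /
      Complex.sin ((ν + 1 / 2) * Real.pi)

lemma aux_series (a : ℕ → ℂ) (e : ℕ → ℕ) (he : Function.Injective e) (B : ℝ) (hB : 0 ≤ B)
    (ha : ∀ k, ‖a k‖ ≤ B ^ e k / (e k).factorial) (z : ℂ) :
    Summable (fun k => a k * z ^ e k) ∧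
    HasSum (fun k => a k * ((e k : ℂ) * z ^ (e k - 1))) (deriv (fun w => ∑' k, a k * w ^ e k) z) ∧
    DifferentiableAt ℂ (fun w => ∑' k, a k * w ^ e k) z := by
  have hs : ∀ r : ℝ, Summable (fun k => (B * r) ^ e k / (e k).factorial) := fun r =>
    (Real.summable_pow_div_factorial (B * r)).comp_injective he
  have hb : ∀ r : ℝ, ∀ k, ∀ w ∈ Metric.ball (0:ℂ) r,
      ‖a k * w ^ e k‖ ≤ (B * r) ^ e k / (e k).factorial := by
    intro r k w hw
    have hw' : ‖w‖ ≤ r := by simpa using (Metric.mem_ball.1 hw).le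
    rw [norm_mul, norm_pow, mul_pow, mul_div_right_comm]
    have := ha k
    gcongr
  have hz : z ∈ Metric.ball (0:ℂ) (‖z‖ + 1) := by simp
  refine ⟨Summable.of_norm_bounded (hs (‖z‖ + 1)) (fun k => hb _ k z hz), ?_, ?_⟩
  · have := Complex.hasSum_deriv_of_summable_norm (F := fun k w => a k * w ^ e k) (hs (‖z‖ + 1))
      (fun k => by fun_prop) Metric.isOpen_ball (hb _) hz
    refine this.congr_fun ?_ |> fun h => h
    intro k
    simp
  · exact (Complex.differentiableOn_tsum_of_summable_norm (F := fun k w => a k * w ^ e k)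
      (hs (‖z‖ + 1)) (fun k => by fun_prop) Metric.isOpen_ball (hb _)).differentiableAt
      (Metric.isOpen_ball.mem_nhds hz)

lemma aux_hasDeriv (a : ℕ → ℂ) (e : ℕ → ℕ) (he : Function.Injective e) (B : ℝ) (hB : 0 ≤ B)
    (ha : ∀ k, ‖a k‖ ≤ B ^ e k / (e k).factorial) (z : ℂ) :
    HasDerivAt (fun w => ∑' k, a k * w ^ e k) (∑' k, a k * ((e k : ℂ) * z ^ (e k - 1))) z := by
  obtain ⟨_, h1, h2⟩ := aux_series a e he B hB ha z
  rw [h1.tsum_eq]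
  exact h2.hasDerivAt

lemma aux_R (k : ℕ) : (Complex.Gamma ((k:ℂ) + 1/2))⁻¹ =
    4 ^ k * k.factorial / ((2*k).factorial * (Real.pi : ℂ) ^ ((1:ℂ)/2)) := by
  induction k with
  | zero => simp only [Nat.cast_zero, zero_add, Complex.Gamma_one_half_eq]; simp
  | succ k ih =>
    have h := Complex.one_div_Gamma_eq_self_mul_one_div_Gamma_add_one ((k:ℂ) + 1/2)
    have hk : (k:ℂ) + 1/2 ≠ 0 := by
      intro h; have := congrArg Complex.re h; norm_num at this; linarith [(Nat.cast_nonneg k : (0:ℝ) ≤ k)]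
    have e1 : (((k+1:ℕ):ℂ) + 1/2) = (k:ℂ) + 1/2 + 1 := by push_cast; ring
    rw [e1]
    rw [ih] at h
    have h2 : (Complex.Gamma ((k:ℂ) + 1/2 + 1))⁻¹ = (4 ^ k * k.factorial / ((2*k).factorial * (Real.pi : ℂ) ^ ((1:ℂ)/2))) / ((k:ℂ) + 1/2) := by
      rw [h, mul_div_cancel_left₀ _ hk]
    rw [h2]
    have hp : (Real.pi : ℂ) ^ ((1:ℂ)/2) ≠ 0 := by
      simp [Complex.cpow_eq_zero_iff, Real.pi_ne_zero]
    have hf : ((2*k).factorial : ℂ) ≠ 0 := by exact_mod_cast (Nat.factorial_ne_zero _)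
    have hk1 : (k:ℂ) + 1 ≠ 0 := by exact_mod_cast Nat.succ_ne_zero k
    have hk2 : 2*(k:ℂ) + 1 ≠ 0 := by exact_mod_cast Nat.succ_ne_zero (2*k)
    have hk3 : 2*(k:ℂ) + 1+1 ≠ 0 := by exact_mod_cast Nat.succ_ne_zero (2*k+1)
    rw [show 2*(k+1) = 2*k+1+1 by ring, Nat.factorial_succ (2*k+1), Nat.factorial_succ (2*k), Nat.factorial_succ k]
    push_cast
    have e7 : (k:ℂ) + 1/2 = (2*(k:ℂ) + 1)/2 := by ring
    rw [e7]
    field_simp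
    ring

noncomputable def oddH (k : ℕ) : ℂ := ∑ j ∈ Finset.range k, 1 / (2 * (j:ℂ) + 1)

lemma aux_Rderiv (k : ℕ) : HasDerivAt (fun s => (Complex.Gamma s)⁻¹)
    ((Complex.Gamma ((k:ℂ) + 1/2))⁻¹ * (Real.eulerMascheroniConstant + 2 * Complex.log 2 - 2 * oddH k))
    ((k:ℂ) + 1/2) := by
  induction k with
  | zero =>
    have h := Complex.hasDerivAt_Gamma_one_half
    have h0 : Complex.Gamma (1/2) ≠ 0 := Complex.Gamma_ne_zero_of_re_pos (by norm_num)
    have := h.inv h0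
    simp only [Nat.cast_zero, zero_add]
    refine HasDerivAt.congr_deriv this ?_
    have hp : (Real.pi : ℂ) ^ ((1:ℂ)/2) ≠ 0 := by
      simp [Complex.cpow_eq_zero_iff, Real.pi_ne_zero]
    have e : ((√Real.pi : ℝ) : ℂ) = (Real.pi : ℂ) ^ ((1:ℂ)/2) := by
      rw [Real.sqrt_eq_rpow, Complex.ofReal_cpow Real.pi_pos.le]; norm_num
    rw [Complex.Gamma_one_half_eq, e]
    simp only [oddH, Finset.range_zero, Finset.sum_empty]
    generalize (Real.pi : ℂ) ^ ((1:ℂ)/2) = p at *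
    field_simp
    ring
  | succ k ih =>
    have hk : (k:ℂ) + 1/2 ≠ 0 := by
      intro h; have := congrArg Complex.re h; norm_num at this; linarith [(Nat.cast_nonneg k : (0:ℝ) ≤ k)]
    have e1 : (((k+1:ℕ):ℂ) + 1/2) = (k:ℂ) + 1/2 + 1 := by push_cast; ring
    rw [e1]
    have h := Complex.one_div_Gamma_eq_self_mul_one_div_Gamma_add_one ((k:ℂ) + 1/2)
    have hd : DifferentiableAt ℂ (fun s => (Complex.Gamma s)⁻¹) ((k:ℂ) + 1/2 + 1) :=
      Complex.differentiable_one_div_Gamma _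
    have h1 : HasDerivAt (fun s => s * (Complex.Gamma (s+1))⁻¹) _ ((k:ℂ) + 1/2) :=
      (hasDerivAt_id' _).mul (hd.hasDerivAt.comp_add_const ((k:ℂ) + 1/2) 1)
    have h2 : (fun s => s * (Complex.Gamma (s+1))⁻¹) = fun s => (Complex.Gamma s)⁻¹ := by
      funext s; exact (Complex.one_div_Gamma_eq_self_mul_one_div_Gamma_add_one s).symm
    rw [h2] at h1
    have h3 := h1.unique ih
    have h4 : deriv (fun s => (Complex.Gamma s)⁻¹) ((k:ℂ) + 1/2 + 1) = (Complex.Gamma ((k:ℂ) + 1/2 + 1))⁻¹ * (Real.eulerMascheroniConstant + 2 * Complex.log 2 - 2 * oddH (k+1)) := by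
      rw [h] at h3
      apply mul_left_cancel₀ hk
      rw [oddH, Finset.sum_range_succ, ← oddH]
      have hk2 : 2*(k:ℂ) + 1 ≠ 0 := by exact_mod_cast Nat.succ_ne_zero (2*k)
      have e5 : (k + 1/2 : ℂ) * (2 * (1 / (2*(k:ℂ)+1))) = 1 := by
        rw [show (k:ℂ) + 1/2 = (2*(k:ℂ) + 1)/2 by ring]; field_simp
      linear_combination h3 + (Complex.Gamma ((k:ℂ) + 1/2 + 1))⁻¹ * e5
    rw [← h4]
    exact hd.hasDerivAt

noncomputable def besS (c ν : ℂ) : ℂ :=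
  ∑' k : ℕ, (-1) ^ k * c ^ k / ((k.factorial : ℂ) * Complex.Gamma (ν + k + 1))

lemma aux_S (c ν₀ : ℂ) (h0 : -1/2 ≤ ν₀.re) :
    DifferentiableAt ℂ (besS c) ν₀ ∧
    HasSum (fun k : ℕ => (-1) ^ k * c ^ k / (k.factorial : ℂ) *
      deriv (fun s => (Complex.Gamma s)⁻¹) (ν₀ + k + 1)) (deriv (besS c) ν₀) := by
  obtain ⟨M, hM⟩ := (isCompact_closedBall ν₀ (1/4)).exists_bound_of_continuousOn
    (f := fun ν => (Complex.Gamma (ν + 1))⁻¹)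
    (Complex.differentiable_one_div_Gamma.continuous.comp (continuous_id.add continuous_const)).continuousOn
  have hG : ∀ k : ℕ, ∀ ν ∈ Metric.ball ν₀ (1/4), ‖(Complex.Gamma (ν + k + 1))⁻¹‖ ≤ 4 ^ k * M := by
    intro k ν hν
    induction k with
    | zero => simpa using hM ν (Metric.ball_subset_closedBall hν)
    | succ k ih =>
      have h := Complex.one_div_Gamma_eq_self_mul_one_div_Gamma_add_one (ν + k + 1)
      have h3 : (1/4 : ℝ) ≤ ‖ν + k + 1‖ := by
        have h1 := Complex.abs_re_le_norm (ν - ν₀)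
        have h2 := mem_ball_iff_norm.1 hν
        have h3 := Complex.re_le_norm (ν + k + 1)
        have h4 := neg_abs_le (ν - ν₀).re
        simp at h3 h4 h1
        linarith [(Nat.cast_nonneg k : (0:ℝ) ≤ k)]
      have e : ν + ((k+1:ℕ):ℂ) + 1 = ν + k + 1 + 1 := by push_cast; ring
      rw [e]
      rw [h, norm_mul] at ih
      have := mul_le_mul_of_nonneg_right h3 (norm_nonneg (Complex.Gamma (ν + k + 1 + 1))⁻¹)
      rw [pow_succ]; linarith
  have hF : ∀ k : ℕ, Differentiable ℂ (fun ν : ℂ => (Complex.Gamma (ν + k + 1))⁻¹) := fun k =>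
    Complex.differentiable_one_div_Gamma.comp (by fun_prop : Differentiable ℂ fun ν : ℂ => ν + k + 1)
  have hS : besS c = fun ν => ∑' k : ℕ, (-1) ^ k * c ^ k / (k.factorial : ℂ) * (Complex.Gamma (ν + k + 1))⁻¹ := by
    funext ν
    simp only [besS, div_eq_mul_inv, mul_inv, mul_assoc]
  have hu : Summable (fun k : ℕ => (‖c‖ * 4) ^ k / (k.factorial : ℝ) * M) :=
    (Real.summable_pow_div_factorial _).mul_right M
  have hb : ∀ (k : ℕ), ∀ ν ∈ Metric.ball ν₀ (1/4), ‖(-1) ^ k * c ^ k / (k.factorial : ℂ) * (Complex.Gamma (ν + k + 1))⁻¹‖ ≤ (‖c‖ * 4) ^ k / (k.factorial : ℝ) * M := by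
    intro k ν hν
    have := hG k ν hν
    rw [norm_mul]
    calc _ ≤ ‖(-1) ^ k * c ^ k / (k.factorial : ℂ)‖ * (4 ^ k * M) := by gcongr
      _ = _ := by simp [mul_pow]; ring
  have hm : ν₀ ∈ Metric.ball ν₀ (1/4) := Metric.mem_ball_self (by norm_num)
  rw [hS]
  constructor
  · exact (Complex.differentiableOn_tsum_of_summable_norm hu
      (fun k => ((hF k).const_mul _).differentiableOn) Metric.isOpen_ball hb).differentiableAt
      (Metric.isOpen_ball.mem_nhds hm)
  · have := Complex.hasSum_deriv_of_summable_norm hu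
      (fun k => ((hF k).const_mul _).differentiableOn) Metric.isOpen_ball hb hm
    refine this.congr_fun ?_
    intro k
    rw [deriv_const_mul _ (hF k _)]
    congr 1
    have := deriv_comp_add_const (fun s => (Complex.Gamma s)⁻¹) ((k:ℂ) + 1) ν₀
    simp only [← add_assoc] at this
    rw [this]

lemma fac_ne (n : ℕ) : (n.factorial : ℂ) ≠ 0 := by exact_mod_cast Nat.factorial_ne_zero n

lemma oddH_norm (k : ℕ) : ‖oddH k‖ ≤ k := by
  unfold oddH
  refine (norm_sum_le _ _).trans ?_
  calc _ ≤ ∑ j ∈ Finset.range k, (1:ℝ) := by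
        refine Finset.sum_le_sum fun j _ => ?_
        rw [norm_div, norm_one]
        have : ‖2 * (j:ℂ) + 1‖ = 2 * (j:ℝ) + 1 := by
          have h : (2 * (j:ℂ) + 1) = ((2 * j + 1 : ℕ) : ℂ) := by push_cast; ring
          rw [h, Complex.norm_natCast]; push_cast; ring
        rw [this, div_le_one (by positivity)]
        linarith [(Nat.cast_nonneg j : (0:ℝ) ≤ j)]
    _ = k := by simp

lemma oddH_succ (k : ℕ) : oddH (k+1) = oddH k + 1 / (2 * (k:ℂ) + 1) := by
  simp [oddH, Finset.sum_range_succ]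

noncomputable def gA (k : ℕ) : ℂ := -2 * (-1) ^ k * oddH k / (2*k).factorial
noncomputable def gB (k : ℕ) : ℂ := -2 * (-1) ^ (k+1) * oddH (k+1) / (2*k+1).factorial
noncomputable def gC (k : ℕ) : ℂ :=
  (-1) ^ (k+1) * 2 ^ (2*(k+1)) / ((2 * ((k:ℂ) + 1)) * ((2 * (k + 1)).factorial : ℂ))
noncomputable def gD (k : ℕ) : ℂ :=
  (-1) ^ k * 2 ^ (2*k+1) / ((2 * (k : ℂ) + 1) * ((2 * k + 1).factorial : ℂ))
noncomputable def gE (k : ℕ) : ℂ := (-1) ^ k / ((2 * k + 1).factorial : ℂ)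

lemma nat_bd (n : ℕ) : (n : ℝ) ≤ 2 ^ n := by exact_mod_cast Nat.lt_two_pow_self.le

lemma gA_bd (k : ℕ) : ‖gA k‖ ≤ 2 ^ (2*k) / (2*k).factorial := by
  have h := oddH_norm k
  have h2 := nat_bd (2*k)
  push_cast at h2
  simp only [gA, norm_div, norm_mul, norm_neg, norm_pow, norm_one, one_pow, Complex.norm_natCast, Complex.norm_ofNat]
  gcongr
  linarith

lemma gB_bd (k : ℕ) : ‖gB k‖ ≤ 4 ^ (2*k+1) / (2*k+1).factorial := by
  have h := oddH_norm (k+1)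
  have h2 := nat_bd (2*k+1)
  have h3 : (1:ℝ) ≤ 2 ^ (2*k+1) := one_le_pow₀ (by norm_num)
  have h4 : (4:ℝ) ^ (2*k+1) = 2 ^ (2*k+1) * 2 ^ (2*k+1) := by rw [← mul_pow]; norm_num
  have h5 : (2:ℝ) ≤ 2 ^ (2*k+1) := by
    rw [pow_succ]; linarith [one_le_pow₀ (by norm_num : (1:ℝ) ≤ 2) (n := 2*k)]
  push_cast at h2 h
  simp only [gB, norm_div, norm_mul, norm_neg, norm_pow, norm_one, one_pow, Complex.norm_natCast, Complex.norm_ofNat]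
  gcongr
  rw [h4]
  nlinarith

lemma gC_bd (k : ℕ) : ‖gC k‖ ≤ 2 ^ (2*(k+1)) / (2*(k+1)).factorial := by
  have h : 2 * ((k:ℂ) + 1) = ((2 * (k + 1) : ℕ) : ℂ) := by push_cast; ring
  rw [gC, h]
  simp only [norm_div, norm_mul, norm_neg, norm_pow, norm_one, one_pow, Complex.norm_natCast, Complex.norm_ofNat, one_mul]
  gcongr
  have : (1:ℝ) ≤ ((2 * (k+1) : ℕ) : ℝ) := by exact_mod_cast (by omega)
  nlinarith [(Nat.cast_nonneg (2*(k+1)).factorial : (0:ℝ) ≤ _)]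

lemma gD_bd (k : ℕ) : ‖gD k‖ ≤ 2 ^ (2*k+1) / (2*k+1).factorial := by
  have h : 2 * (k:ℂ) + 1 = ((2 * k + 1 : ℕ) : ℂ) := by push_cast; ring
  rw [gD, h]
  simp only [norm_div, norm_mul, norm_neg, norm_pow, norm_one, one_pow, Complex.norm_natCast, Complex.norm_ofNat, one_mul]
  gcongr
  have : (1:ℝ) ≤ ((2 * k + 1 : ℕ) : ℝ) := by exact_mod_cast (by omega)
  nlinarith [(Nat.cast_nonneg (2*k+1).factorial : (0:ℝ) ≤ _)]

lemma inj_e : Function.Injective (fun k : ℕ => 2 * k) := fun a b h => by simpa using h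
lemma inj_o : Function.Injective (fun k : ℕ => 2 * k + 1) := fun a b h => by simpa using h
lemma inj_p : Function.Injective (fun k : ℕ => 2 * (k + 1)) := fun a b h => by simpa using h

noncomputable def fA (z : ℂ) : ℂ := ∑' k, gA k * z ^ (2*k)
noncomputable def fB (z : ℂ) : ℂ := ∑' k, gB k * z ^ (2*k+1)
noncomputable def fC (z : ℂ) : ℂ := ∑' k, gC k * z ^ (2*(k+1))
noncomputable def fD (z : ℂ) : ℂ := ∑' k, gD k * z ^ (2*k+1)
noncomputable def fE (z : ℂ) : ℂ := ∑' k, gE k * z ^ (2*k)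

lemma fE_mul (z : ℂ) : z * fE z = Complex.sin z := by
  rw [fE, ← tsum_mul_left, ← (Complex.hasSum_sin z).tsum_eq]
  congr 1; funext k
  rw [gE]; ring

lemma fE_zero : fE 0 = 1 := by
  rw [fE, tsum_eq_single 0]
  · simp [gE]
  · intro k hk; simp [hk]

lemma fA_deriv (z : ℂ) : HasDerivAt fA (fB z) z := by
  have h := aux_hasDeriv gA _ inj_e 2 (by norm_num) gA_bd z
  have hs := (aux_series gA _ inj_e 2 (by norm_num) gA_bd z).2.1.summable
  refine HasDerivAt.congr_deriv h ?_
  rw [hs.tsum_eq_zero_add, fB]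
  simp only [Nat.mul_zero, Nat.cast_zero, zero_mul, mul_zero, zero_add]
  congr 1; funext k
  rw [gA, gB, show 2*(k+1) = 2*k+1+1 by ring, Nat.factorial_succ (2*k+1)]
  have := fac_ne (2*k+1)
  have hk3 : 2*(k:ℂ) + 1+1 ≠ 0 := by exact_mod_cast Nat.succ_ne_zero (2*k+1)
  push_cast
  field_simp

lemma fB_deriv (z : ℂ) : HasDerivAt fB (2 * fE z - fA z) z := by
  have h := aux_hasDeriv gB _ inj_o 4 (by norm_num) gB_bd z
  have hA := (aux_series gA _ inj_e 2 (by norm_num) gA_bd z).1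
  have hB := (aux_series gB _ inj_o 4 (by norm_num) gB_bd z).2.1.summable
  refine HasDerivAt.congr_deriv h ?_
  rw [eq_sub_iff_add_eq, fA, ← hB.tsum_add hA, fE, ← tsum_mul_left]
  congr 1; funext k
  rw [gA, gB, gE, Nat.add_sub_cancel, Nat.factorial_succ (2*k), oddH_succ]
  have := fac_ne (2*k)
  have hk3 : 2*(k:ℂ) + 1 ≠ 0 := by exact_mod_cast Nat.succ_ne_zero (2*k)
  push_cast
  field_simp
  ring

lemma fC_deriv (z : ℂ) : HasDerivAt fC (- 2 * Complex.sin z * fE z) z := by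
  have h := aux_hasDeriv gC _ inj_p 2 (by norm_num) gC_bd z
  refine HasDerivAt.congr_deriv h ?_
  by_cases hz : z = 0
  · subst hz
    simp [fE_zero]
    convert tsum_zero with k
    simp; right
    omega
  · apply mul_left_cancel₀ hz
    have e1 : z * (-2 * Complex.sin z * fE z) = Complex.cos (2*z) - 1 := by
      rw [Complex.cos_two_mul, Complex.cos_sq']
      linear_combination (-2 * Complex.sin z) * fE_mul z
    have hc := Complex.hasSum_cos (2*z)
    rw [e1, ← hc.tsum_eq, hc.summable.tsum_eq_zero_add, ← tsum_mul_left]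
    simp only [Nat.mul_zero, pow_zero, Nat.factorial_zero, Nat.cast_one, mul_one, div_one, add_sub_cancel_left]
    congr 1; funext k
    rw [gC]
    have := fac_ne (2*(k+1))
    have hk1 : (k:ℂ) + 1 ≠ 0 := by exact_mod_cast Nat.succ_ne_zero k
    rw [show 2*(k+1)-1 = 2*k+1 by omega]
    push_cast
    field_simp
    ring

lemma fD_deriv (z : ℂ) : HasDerivAt fD (2 * Complex.cos z * fE z) z := by
  have h := aux_hasDeriv gD _ inj_o 2 (by norm_num) gD_bd z
  refine HasDerivAt.congr_deriv h ?_
  by_cases hz : z = 0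
  · subst hz
    rw [fE_zero, tsum_eq_single 0]
    · simp [gD]
    · intro k hk; simp [hk]
  · apply mul_left_cancel₀ hz
    have e1 : z * (2 * Complex.cos z * fE z) = Complex.sin (2*z) := by
      rw [Complex.sin_two_mul]
      linear_combination (2 * Complex.cos z) * fE_mul z
    rw [e1, ← (Complex.hasSum_sin (2*z)).tsum_eq, ← tsum_mul_left]
    congr 1; funext k
    rw [gD]
    have := fac_ne (2*k+1)
    have hk3 : 2*(k:ℂ) + 1 ≠ 0 := by exact_mod_cast Nat.succ_ne_zero (2*k)
    rw [Nat.add_sub_cancel]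
    push_cast
    field_simp
    ring

lemma fA_zero : fA 0 = 0 := by
  rw [fA, tsum_eq_single 0]
  · simp [gA, oddH]
  · intro k hk; simp [hk]
lemma fB_zero : fB 0 = 0 := by simp [fB]
lemma fC_zero : fC 0 = 0 := by simp [fC]
lemma fD_zero : fD 0 = 0 := by simp [fD]

lemma fC_eq (z : ℂ) : fA z * Complex.cos z - fB z * Complex.sin z = fC z := by
  have h : ∀ z, HasDerivAt (fun z => fA z * Complex.cos z - fB z * Complex.sin z - fC z) 0 z := by
    intro z
    refine ((((fA_deriv z).mul (Complex.hasDerivAt_cos z)).sub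
      ((fB_deriv z).mul (Complex.hasDerivAt_sin z))).sub (fC_deriv z)).congr_deriv ?_
    ring
  have := is_const_of_deriv_eq_zero (fun z => (h z).differentiableAt) (fun z => (h z).deriv) z 0
  simp only [fA_zero, fB_zero, fC_zero] at this
  linear_combination this

lemma fD_eq (z : ℂ) : fA z * Complex.sin z + fB z * Complex.cos z = fD z := by
  have h : ∀ z, HasDerivAt (fun z => fA z * Complex.sin z + fB z * Complex.cos z - fD z) 0 z := by
    intro z
    refine ((((fA_deriv z).mul (Complex.hasDerivAt_sin z)).add
      ((fB_deriv z).mul (Complex.hasDerivAt_cos z))).sub (fD_deriv z)).congr_deriv ?_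
    ring
  have := is_const_of_deriv_eq_zero (fun z => (h z).differentiableAt) (fun z => (h z).deriv) z 0
  simp only [fA_zero, fB_zero, fD_zero] at this
  linear_combination this

lemma fA_eq (z : ℂ) : fA z = fC z * Complex.cos z + fD z * Complex.sin z := by
  rw [← fC_eq, ← fD_eq]
  linear_combination (- fA z) * Complex.sin_sq_add_cos_sq z

lemma Si_eq (z : ℂ) : sinIntegral (2*z) = fD z := by
  rw [sinIntegral, fD]
  congr 1; funext k
  rw [gD, mul_pow]; ring

lemma Ci_eq (z : ℂ) : cosIntegral (2*z) = Real.eulerMascheroniConstant + Complex.log (2*z) + fC z := by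
  rw [cosIntegral, fC]
  congr 2; funext k
  rw [gC, mul_pow]; ring

lemma besS_half (z : ℂ) : (Real.pi : ℂ) ^ ((1:ℂ)/2) * (z * besS (z^2/4) (1/2)) = 2 * Complex.sin z := by
  rw [besS, ← (Complex.hasSum_sin z).tsum_eq, ← tsum_mul_left, ← tsum_mul_left, ← tsum_mul_left]
  congr 1; funext k
  have h := aux_R (k+1)
  rw [show (((k+1:ℕ):ℂ) + 1/2) = 1/2 + (k:ℂ) + 1 by push_cast; ring] at h
  rw [div_eq_mul_inv _ ((k.factorial : ℂ) * _), mul_inv, h]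
  have hp : (Real.pi : ℂ) ^ ((1:ℂ)/2) ≠ 0 := by
    simp [Complex.cpow_eq_zero_iff, Real.pi_ne_zero]
  generalize (Real.pi : ℂ) ^ ((1:ℂ)/2) = p at *
  rw [show 2*(k+1) = 2*k+1+1 by ring, Nat.factorial_succ (2*k+1), Nat.factorial_succ k, div_pow]
  have := fac_ne (2*k+1)
  have := fac_ne k
  have hk1 : (k:ℂ) + 1 ≠ 0 := by exact_mod_cast Nat.succ_ne_zero k
  push_cast
  rw [show 2*(k:ℂ) + 1 + 1 = 2 * (k+1) by ring]
  field_simp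
  ring

lemma besS_neg (z : ℂ) : (Real.pi : ℂ) ^ ((1:ℂ)/2) * besS (z^2/4) (-(1/2)) = Complex.cos z := by
  rw [besS, ← (Complex.hasSum_cos z).tsum_eq, ← tsum_mul_left]
  congr 1; funext k
  have h := aux_R k
  rw [show ((k:ℂ) + 1/2) = -(1/2) + (k:ℂ) + 1 by ring] at h
  rw [div_eq_mul_inv _ ((k.factorial : ℂ) * _), mul_inv, h]
  have hp : (Real.pi : ℂ) ^ ((1:ℂ)/2) ≠ 0 := by
    simp [Complex.cpow_eq_zero_iff, Real.pi_ne_zero]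
  generalize (Real.pi : ℂ) ^ ((1:ℂ)/2) = p at *
  rw [div_pow]
  have := fac_ne (2*k)
  have := fac_ne k
  field_simp
  ring

lemma besS_deriv (z : ℂ) : (Real.pi : ℂ) ^ ((1:ℂ)/2) * deriv (besS (z^2/4)) (-(1/2)) =
    (Real.eulerMascheroniConstant + 2 * Complex.log 2) * Complex.cos z + fA z := by
  have h0 := (aux_S (z^2/4) (-(1/2)) (by norm_num)).2
  have hA := (aux_series gA _ inj_e 2 (by norm_num) gA_bd z).1
  have hc := (Complex.hasSum_cos z).mul_left (Real.eulerMascheroniConstant + 2 * Complex.log 2)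
  refine (h0.mul_left _).unique ?_
  refine (hc.add hA.hasSum).congr_fun ?_
  intro k
  have h := (aux_Rderiv k).deriv
  rw [aux_R k] at h
  rw [show ((k:ℂ) + 1/2) = -(1/2) + (k:ℂ) + 1 by ring] at h
  rw [h, gA]
  have hp : (Real.pi : ℂ) ^ ((1:ℂ)/2) ≠ 0 := by
    simp [Complex.cpow_eq_zero_iff, Real.pi_ne_zero]
  generalize (Real.pi : ℂ) ^ ((1:ℂ)/2) = p at *
  rw [div_pow]
  have := fac_ne (2*k)
  have := fac_ne k
  field_simp
  ring

theorem stmt8 (z : ℂ) (hz : z ∉ Complex.ofReal '' Set.Iic (0 : ℝ)) :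
    deriv (fun ν : ℂ => sphBesselY ν z) 0 =
      (cosIntegral (2 * z) * Complex.cos z +
        (sinIntegral (2 * z) - Real.pi) * Complex.sin z) / z := by
  have hz0 : z ≠ 0 := by
    rintro rfl; exact hz ⟨0, by simp, by simp⟩
  have harg : z.arg ≠ Real.pi := by
    intro h
    rw [Complex.arg_eq_pi_iff] at h
    exact hz ⟨z.re, h.1.le, by apply Complex.ext <;> simp [h.2]⟩
  have hl2 : Complex.log (2 * z) = Real.log 2 + Complex.log z := by
    have := Complex.log_ofReal_mul (r := 2) (by norm_num) hz0
    simpa using this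
  have hlh : Complex.log (z / 2) = Complex.log z - Real.log 2 := by
    have := Complex.log_ofReal_mul (r := 2⁻¹) (by norm_num) hz0
    rw [Real.log_inv] at this
    rw [show z / 2 = ((2⁻¹ : ℝ) : ℂ) * z by push_cast; ring, this]
    push_cast; ring
  have hlog2 : Complex.log 2 = Real.log 2 := by
    rw [Complex.ofReal_log (by norm_num)]; simp
  have hlp : Complex.log (Real.pi / (2 * z)) = Real.log Real.pi - Real.log 2 - Complex.log z := by
    have h1 := Complex.log_ofReal_mul (r := Real.pi / 2) (by positivity) (inv_ne_zero hz0)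
    rw [Complex.log_inv _ harg, Real.log_div Real.pi_ne_zero (by norm_num)] at h1
    rw [show (Real.pi : ℂ) / (2 * z) = ((Real.pi / 2 : ℝ) : ℂ) * z⁻¹ by push_cast; field_simp, h1]
    push_cast; ring
  have hzh : z / 2 ≠ 0 := div_ne_zero hz0 (by norm_num)
  have hpi : (Real.pi : ℂ) ≠ 0 := by exact_mod_cast Real.pi_ne_zero
  have hpz : (Real.pi : ℂ) / (2 * z) ≠ 0 := by simp [hz0, Real.pi_ne_zero]
  have hC1 : ((Real.pi : ℂ) / (2 * z)) ^ ((1 : ℂ) / 2) * (z/2) ^ ((1:ℂ)/2) =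
      (Real.pi : ℂ) ^ ((1:ℂ)/2) / 2 := by
    rw [Complex.cpow_def_of_ne_zero hpz, Complex.cpow_def_of_ne_zero hzh,
      Complex.cpow_def_of_ne_zero hpi, ← Complex.exp_add, hlp, hlh, ← Complex.ofReal_log Real.pi_pos.le,
      show ((Real.log Real.pi : ℂ) - Real.log 2 - Complex.log z) * (1/2) + (Complex.log z - Real.log 2) * (1/2)
        = Real.log Real.pi * (1/2) - Complex.log 2 by rw [hlog2]; ring,
      Complex.exp_sub, Complex.exp_log (by norm_num)]
  have hC2 : ((Real.pi : ℂ) / (2 * z)) ^ ((1 : ℂ) / 2) * (z/2) ^ (-((1:ℂ)/2)) =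
      (Real.pi : ℂ) ^ ((1:ℂ)/2) / z := by
    rw [Complex.cpow_def_of_ne_zero hpz, Complex.cpow_def_of_ne_zero hzh,
      Complex.cpow_def_of_ne_zero hpi, ← Complex.exp_add, hlp, hlh, ← Complex.ofReal_log Real.pi_pos.le,
      show ((Real.log Real.pi : ℂ) - Real.log 2 - Complex.log z) * (1/2) + (Complex.log z - Real.log 2) * -(1/2)
        = Real.log Real.pi * (1/2) - Complex.log z by ring,
      Complex.exp_sub, Complex.exp_log hz0]
  have hJ : ∀ ν, besselJ ν z = (z/2) ^ ν * besS (z^2/4) ν := fun ν => rfl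
  have hJd : ∀ ν : ℂ, -1/2 ≤ ν.re → HasDerivAt (fun ν => besselJ ν z)
      ((z/2) ^ ν * Complex.log (z/2) * besS (z^2/4) ν + (z/2) ^ ν * deriv (besS (z^2/4)) ν) ν := by
    intro ν hν
    have h1 : HasDerivAt (fun ν : ℂ => (z/2) ^ ν) ((z/2) ^ ν * Complex.log (z/2)) ν := by
      simpa using (hasDerivAt_id' ν).const_cpow (c := z/2) (Or.inl hzh)
    exact h1.mul (aux_S (z^2/4) ν hν).1.hasDerivAt
  have d1 : HasDerivAt (fun ν : ℂ => besselJ (ν + 1/2) z) _ 0 :=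
    HasDerivAt.comp_add_const (0:ℂ) (1/2:ℂ) (hJd (0 + 1/2) (by norm_num))
  have hneg : (-0 - 1/2 : ℂ) = -(1/2) := by ring
  have hin2 : HasDerivAt (fun ν : ℂ => -ν - 1/2) (-1) 0 := (hasDerivAt_id' 0).neg.sub_const _
  have d2 : HasDerivAt (fun ν : ℂ => besselJ (-ν - 1/2) z) _ 0 :=
    HasDerivAt.comp (h₂ := fun ν => besselJ ν z) (0:ℂ) (hJd (-0 - 1/2) (by norm_num)) hin2
  have hin : HasDerivAt (fun ν : ℂ => (ν + 1/2) * Real.pi) Real.pi 0 := by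
    simpa using ((hasDerivAt_id' (0:ℂ)).add_const (1/2:ℂ)).mul_const (Real.pi : ℂ)
  have d3 := hin.ccos
  have d4 := hin.csin
  have e0 : ((0:ℂ) + 1/2) * Real.pi = Real.pi / 2 := by ring
  have hs : Complex.sin (((0:ℂ) + 1/2) * Real.pi) ≠ 0 := by rw [e0, Complex.sin_pi_div_two]; simp
  have d := (((d1.mul d3).sub d2).const_mul (((Real.pi : ℂ) / (2 * z)) ^ ((1 : ℂ) / 2))).div d4 hs
  refine Eq.trans (HasDerivAt.deriv d) ?_
  have e1 : (1/2 : ℂ) * Real.pi = Real.pi / 2 := by ring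
  simp only [Pi.mul_apply, Pi.sub_apply, e1, hneg, Complex.sin_pi_div_two, Complex.cos_pi_div_two, zero_add, hJ]
  rw [Ci_eq, Si_eq, hl2]
  have hb1 := besS_half z
  have hb2 := besS_neg z
  have hb3 := besS_deriv z
  rw [hlog2] at hb3
  rw [hlh]
  have hA := fA_eq z
  set K := ((Real.pi : ℂ) / (2 * z)) ^ ((1 : ℂ) / 2)
  set p := (Real.pi : ℂ) ^ ((1:ℂ)/2)
  have t1 : K * ((z/2) ^ ((1:ℂ)/2) * besS (z^2/4) (1/2)) = Complex.sin z / z := by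
    rw [← mul_assoc, hC1]; field_simp; linear_combination hb1
  have t2 : K * ((z/2) ^ (-((1:ℂ)/2)) * besS (z^2/4) (-(1/2))) = Complex.cos z / z := by
    rw [← mul_assoc, hC2]; field_simp; linear_combination hb2
  have t3 : K * ((z/2) ^ (-((1:ℂ)/2)) * deriv (besS (z^2/4)) (-(1/2))) =
    ((Real.eulerMascheroniConstant + 2 * Real.log 2) * Complex.cos z + fA z) / z := by
    rw [← mul_assoc, hC2]; field_simp; linear_combination hb3
  rw [hA] at t3
  linear_combination (-Real.pi : ℂ) * t1 + (Complex.log z - Real.log 2) * t2 + t3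
end

section
/- For every z ∈ ℂ with z ≠ 0 and every t ∈ ℂ, (1/z)·cosh((z² + 2izt)^{1/2}) = i⁻_0(z) + ∑_{n=1}^∞ ((it)^n/n!) · i⁺_{n−1}(z), where the power 1/2 denotes the principal complex square root (the value of cosh of a square root is independent of the choice of sign). -/
open Complex

/-- The (modified) Rayleigh operator `D`, sending `h` to `z ↦ h′(z)/z`. -/
noncomputable def rayleighDmod (h : ℂ → ℂ) : ℂ → ℂ := fun z => deriv h z / z

/-- The modified spherical Bessel function of the first kind
`i⁺_n(z) = zⁿ (Dⁿ (sinh w / w))(z)`. -/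
noncomputable def sphiPlus (n : ℕ) (z : ℂ) : ℂ :=
  z ^ n * (rayleighDmod^[n] (fun w => Complex.sinh w / w)) z

/-- The modified spherical Bessel function of the second kind (in the sense of
`i⁻_n(z) = √(π/(2z)) I_{−n−1/2}(z)`), `i⁻_n(z) = zⁿ (Dⁿ (cosh w / w))(z)`. -/
noncomputable def sphiMinus (n : ℕ) (z : ℂ) : ℂ :=
  z ^ n * (rayleighDmod^[n] (fun w => Complex.cosh w / w)) z

noncomputable def coshRoot (w : ℂ) : ℂ := Complex.cosh (w ^ ((1 : ℂ) / 2))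

lemma root_sq (w : ℂ) : (w ^ ((1 : ℂ) / 2)) ^ 2 = w := by
  have := Complex.cpow_nat_inv_pow w (n := 2) (by norm_num)
  simpa [one_div] using this

lemma cosh_eq_of_sq {a b : ℂ} (h : a ^ 2 = b ^ 2) : Complex.cosh a = Complex.cosh b := by
  rcases sq_eq_sq_iff_eq_or_eq_neg.1 h with h | h
  · rw [h]
  · rw [h, Complex.cosh_neg]

lemma coshRoot_sq (w : ℂ) : coshRoot (w ^ 2) = Complex.cosh w :=
  cosh_eq_of_sq (root_sq _)

lemma coshRoot_neg (w : ℂ) :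
    coshRoot w = Complex.cosh (Complex.I * (-w) ^ ((1 : ℂ) / 2)) := by
  apply cosh_eq_of_sq
  rw [mul_pow, root_sq, root_sq]
  simp

lemma coshRoot_diff : Differentiable ℂ coshRoot := by
  have h1 : DifferentiableOn ℂ coshRoot (Set.univ \ {0}) := by
    intro w hw
    have hw0 : w ≠ 0 := by simpa using hw
    apply DifferentiableAt.differentiableWithinAt
    by_cases hs : w ∈ Complex.slitPlane
    · unfold coshRoot
      exact (differentiableAt_id.cpow_const hs).ccosh
    · have hs' : -w ∈ Complex.slitPlane := by
        rw [Complex.mem_slitPlane_iff] at hs ⊢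
        push Not at hs
        left
        have : w.re ≠ 0 := fun h => hw0 (Complex.ext h hs.2)
        have := lt_of_le_of_ne hs.1 this
        simpa using this
      rw [funext coshRoot_neg]
      exact ((differentiableAt_id.neg.cpow_const hs').const_mul _).ccosh
  have h2 : ContinuousAt coshRoot 0 := by
    unfold coshRoot
    apply Complex.continuous_cosh.continuousAt.comp
    exact Complex.continuousAt_cpow_const_of_re_pos (Or.inl (by simp)) (by norm_num)
  have := (Complex.differentiableOn_compl_singleton_and_continuousAt_iff
    (s := Set.univ) (c := (0 : ℂ)) Filter.univ_mem).1 ⟨h1, h2⟩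
  exact differentiableOn_univ.1 this

lemma iter_diff (n : ℕ) : Differentiable ℂ (iteratedDeriv n coshRoot) :=
  (coshRoot_diff.contDiff (n := ⊤)).differentiable_iteratedDeriv n (by exact_mod_cast WithTop.coe_lt_top _)

lemma iter_hasDeriv (n : ℕ) (w : ℂ) :
    HasDerivAt (fun w => iteratedDeriv n coshRoot (w ^ 2))
      (iteratedDeriv (n + 1) coshRoot (w ^ 2) * (2 * w)) w := by
  have h := (iter_diff n (w ^ 2)).hasDerivAt
  rw [← iteratedDeriv_succ] at h
  have h2 := hasDerivAt_pow 2 w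
  have h3 := h.comp w h2
  simp only [Nat.cast_ofNat, Nat.add_one_sub_one, pow_one] at h3
  exact h3

lemma D_iter (n : ℕ) : ∀ w : ℂ, w ≠ 0 →
    (rayleighDmod^[n] (fun w => Complex.sinh w / w)) w
      = 2 ^ (n + 1) * iteratedDeriv (n + 1) coshRoot (w ^ 2) := by
  induction n with
  | zero =>
    intro w hw
    have h := iter_hasDeriv 0 w
    simp only [iteratedDeriv_zero, coshRoot_sq] at h
    have := h.unique (Complex.hasDerivAt_cosh w)
    simp only [Function.iterate_zero, id, ← this]
    field_simp
    ring
  | succ n ih =>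
    intro w hw
    rw [Function.iterate_succ_apply']
    unfold rayleighDmod at ih ⊢
    have he : (fun h z => deriv h z / z)^[n] (fun w => Complex.sinh w / w) =ᶠ[nhds w]
        fun w => 2 ^ (n + 1) * iteratedDeriv (n + 1) coshRoot (w ^ 2) := by
      filter_upwards [isOpen_ne.mem_nhds hw] with v hv using ih v hv
    rw [he.deriv_eq, ((iter_hasDeriv (n + 1) w).const_mul _).deriv]
    field_simp
    ring

theorem stmt12 (z : ℂ) (hz : z ≠ 0) (t : ℂ) :
    HasSum
      (fun n : ℕ =>
        match n with
        | 0 => sphiMinus 0 z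
        | m + 1 => (Complex.I * t) ^ (m + 1) / ((m + 1).factorial : ℂ) * sphiPlus m z)
      ((1 / z) * Complex.cosh ((z ^ 2 + 2 * Complex.I * z * t) ^ ((1 : ℂ) / 2))) := by
  have h := (Complex.hasSum_taylorSeries_of_entire coshRoot_diff (z ^ 2)
    (z ^ 2 + 2 * Complex.I * z * t)).mul_left (1 / z)
  refine h.congr_fun ?_
  intro n
  cases n with
  | zero =>
    simp [sphiMinus, coshRoot_sq]
    field_simp
  | succ m =>
    simp only [sphiPlus, D_iter m z hz, smul_eq_mul, add_sub_cancel_left]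
    field_simp
    ring
end
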